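/- arXiv:1710.03398 — 2 statements merged into one kernel-verified Lean document; each statement's English description precedes it below -/
import Mathlib

section
/- Let A ∈ ℝ^{n×n} be diagonalizable over ℂ with all eigenvalues of modulus 1, let B ∈ ℝ^{n×m} with (A,B) reachable, and let X ∈ ℝ^{n×n} be symmetric positive definite with X = AᵀXA and I_m − BᵀXB positive semidefinite. Set F = BᵀXA. Then A − BF is Schur stable: every complex eigenvalue of A − BF has modulus strictly less than 1. -/
open Matrix

/-- An eigenvalue `c = α + iβ` of a real matrix yields real vectors `a`, `b`, not both zero,
with `M (a + ib) = c (a + ib)`. -/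
lemma exists_real_pair_of_mem_spectrum {n : ℕ} (M : Matrix (Fin n) (Fin n) ℝ) (c : ℂ)
    (hc : c ∈ spectrum ℂ (M.map Complex.ofReal)) :
    ∃ a b : Fin n → ℝ, (a ≠ 0 ∨ b ≠ 0) ∧ M *ᵥ a = c.re • a - c.im • b ∧
      M *ᵥ b = c.im • a + c.re • b := by
  rw [← Matrix.spectrum_toLin', ← Module.End.hasEigenvalue_iff_mem_spectrum] at hc
  obtain ⟨v, hv⟩ := hc.exists_hasEigenvector
  have hMv : M.map Complex.ofReal *ᵥ v = c • v := by
    simpa using hv.apply_eq_smul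
  refine ⟨fun i => (v i).re, fun i => (v i).im, ?_, ?_, ?_⟩
  · by_contra! h
    exact hv.2 (funext fun i => Complex.ext (congrFun h.1 i) (congrFun h.2 i))
  · ext i
    simpa [mulVec, dotProduct] using congrArg Complex.re (congrFun hMv i)
  · ext i
    have h := congrArg Complex.im (congrFun hMv i)
    simp only [mulVec, dotProduct, map_apply, Complex.im_sum,
      Pi.smul_apply, smul_eq_mul, Complex.mul_im] at h
    simpa [mulVec, dotProduct, add_comm] using h

/-- A symmetric matrix may be moved across the dot product. -/
lemma dotProduct_mulVec_comm_of_isSymm {n : ℕ} {X : Matrix (Fin n) (Fin n) ℝ} (hX : Xᵀ = X)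
    (x y : Fin n → ℝ) : x ⬝ᵥ X *ᵥ y = y ⬝ᵥ X *ᵥ x := by
  rw [dotProduct_mulVec, ← mulVec_transpose, hX, dotProduct_comm]

/-- Feedback through `Bᵀ X` decreases the quadratic form of `X` by at least `‖Bᵀ X y‖²`. -/
lemma quadForm_sub_feedback_le {n m : ℕ} {X : Matrix (Fin n) (Fin n) ℝ}
    {B : Matrix (Fin n) (Fin m) ℝ} (hX : Xᵀ = X)
    (hXB : ((1 : Matrix (Fin m) (Fin m) ℝ) - Bᵀ * X * B).PosSemidef) (y : Fin n → ℝ) :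
    (y - B *ᵥ (Bᵀ *ᵥ (X *ᵥ y))) ⬝ᵥ X *ᵥ (y - B *ᵥ (Bᵀ *ᵥ (X *ᵥ y))) ≤
      y ⬝ᵥ X *ᵥ y - (Bᵀ *ᵥ (X *ᵥ y)) ⬝ᵥ (Bᵀ *ᵥ (X *ᵥ y)) := by
  set u := Bᵀ *ᵥ (X *ᵥ y) with hu
  have hB (z : Fin n → ℝ) : (B *ᵥ u) ⬝ᵥ z = u ⬝ᵥ Bᵀ *ᵥ z := by
    rw [dotProduct_mulVec, vecMul_transpose]
  have hpsd := hXB.dotProduct_mulVec_nonneg u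
  simp only [star_trivial, sub_mulVec, one_mulVec, dotProduct_sub, ← mulVec_mulVec] at hpsd
  have hcross : (B *ᵥ u) ⬝ᵥ X *ᵥ y = u ⬝ᵥ u := by rw [hB]
  have hcross' := dotProduct_mulVec_comm_of_isSymm hX y (B *ᵥ u)
  have hquad := hB (X *ᵥ (B *ᵥ u))
  simp only [mulVec_sub, sub_dotProduct, dotProduct_sub]
  linarith

/-- If `p`, `q` span a `C`-invariant space on which `D` vanishes, then `D` vanishes on their
iterates under `C`. -/
lemma mulVec_pow_eq_zero_of_invariant_pair {n m : ℕ} {C : Matrix (Fin n) (Fin n) ℝ}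
    {D : Matrix (Fin m) (Fin n) ℝ} {p q : Fin n → ℝ} {s t s' t' : ℝ}
    (hp : C *ᵥ p = s • p + t • q) (hq : C *ᵥ q = s' • p + t' • q)
    (hDp : D *ᵥ p = 0) (hDq : D *ᵥ q = 0) (k : ℕ) :
    D *ᵥ (C ^ k *ᵥ p) = 0 ∧ D *ᵥ (C ^ k *ᵥ q) = 0 := by
  induction k with
  | zero => simp [hDp, hDq]
  | succ k ih =>
    simp only [pow_succ, ← mulVec_mulVec, hp, hq, mulVec_add, mulVec_smul, ih.1, ih.2,
      smul_zero, add_zero, and_self]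

/-- Lemma 2 (final claim): `A − BF` is Schur stable, where `F = BᵀXA`. -/
theorem stmt9 (n m : ℕ)
    (A : Matrix (Fin n) (Fin n) ℝ) (B : Matrix (Fin n) (Fin m) ℝ)
    (hdiag : ∃ P : Matrix (Fin n) (Fin n) ℂ, IsUnit P ∧
      (P⁻¹ * A.map Complex.ofReal * P).IsDiag)
    (hspec : ∀ c ∈ spectrum ℂ (A.map Complex.ofReal), ‖c‖ = 1)
    (hreach : ∀ w : Fin n → ℝ, (∀ k : ℕ, Bᵀ *ᵥ ((Aᵀ) ^ k *ᵥ w) = 0) → w = 0)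
    (X : Matrix (Fin n) (Fin n) ℝ) (hX : X.PosDef) (hXA : X = Aᵀ * X * A)
    (hXB : ((1 : Matrix (Fin m) (Fin m) ℝ) - Bᵀ * X * B).PosSemidef)
    (F : Matrix (Fin m) (Fin n) ℝ) (hF : F = Bᵀ * X * A) :
    ∀ c ∈ spectrum ℂ ((A - B * F).map Complex.ofReal), ‖c‖ < 1 := by
  intro c hc
  by_contra! hc1
  obtain ⟨a, b, hab, ha, hb⟩ := exists_real_pair_of_mem_spectrum _ c hc
  have hXs : Xᵀ = X := by simpa using hX.isHermitian.eq
  have hfb (x : Fin n → ℝ) :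
      (A - B * F) *ᵥ x = A *ᵥ x - B *ᵥ (Bᵀ *ᵥ (X *ᵥ (A *ᵥ x))) := by
    simp only [hF, sub_mulVec, mulVec_mulVec, Matrix.mul_assoc]
  have hXAx (x : Fin n → ℝ) : Aᵀ *ᵥ (X *ᵥ (A *ᵥ x)) = X *ᵥ x := by
    conv_rhs => rw [hXA]
    simp only [mulVec_mulVec, Matrix.mul_assoc]
  have hQA (x : Fin n → ℝ) : (A *ᵥ x) ⬝ᵥ X *ᵥ (A *ᵥ x) = x ⬝ᵥ X *ᵥ x := by
    rw [← hXAx x, dotProduct_mulVec x, vecMul_transpose]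
  have hdec (x : Fin n → ℝ) := quadForm_sub_feedback_le hXs hXB (A *ᵥ x)
  simp only [← hfb, hQA] at hdec
  have hr : 1 ≤ c.re ^ 2 + c.im ^ 2 := by
    have h := Complex.sq_norm c
    rw [Complex.normSq_apply] at h
    nlinarith
  have hnonneg (x : Fin n → ℝ) : 0 ≤ x ⬝ᵥ X *ᵥ x := by
    simpa using hX.posSemidef.dotProduct_mulVec_nonneg x
  have hsq (u : Fin m → ℝ) : 0 ≤ u ⬝ᵥ u := by simpa using dotProduct_star_self_nonneg u
  have hsum : (c.re ^ 2 + c.im ^ 2) * (a ⬝ᵥ X *ᵥ a + b ⬝ᵥ X *ᵥ b) ≤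
      (a ⬝ᵥ X *ᵥ a + b ⬝ᵥ X *ᵥ b) -
        (Bᵀ *ᵥ (X *ᵥ (A *ᵥ a))) ⬝ᵥ (Bᵀ *ᵥ (X *ᵥ (A *ᵥ a))) -
        (Bᵀ *ᵥ (X *ᵥ (A *ᵥ b))) ⬝ᵥ (Bᵀ *ᵥ (X *ᵥ (A *ᵥ b))) := by
    have h1 := hdec a
    have h2 := hdec b
    rw [ha] at h1
    rw [hb] at h2
    simp only [mulVec_sub, mulVec_add, mulVec_smul, sub_dotProduct, dotProduct_sub,
      add_dotProduct, dotProduct_add, smul_dotProduct, dotProduct_smul, smul_eq_mul,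
      dotProduct_mulVec_comm_of_isSymm hXs b a] at h1 h2
    simp only [mulVec_mulVec] at h1 h2 ⊢
    linarith
  have hge := mul_le_mul_of_nonneg_right hr (add_nonneg (hnonneg a) (hnonneg b))
  have hua : Bᵀ *ᵥ (X *ᵥ (A *ᵥ a)) = 0 := dotProduct_self_eq_zero.mp <| by
    linarith [hsq (Bᵀ *ᵥ (X *ᵥ (A *ᵥ a))), hsq (Bᵀ *ᵥ (X *ᵥ (A *ᵥ b)))]
  have hub : Bᵀ *ᵥ (X *ᵥ (A *ᵥ b)) = 0 := dotProduct_self_eq_zero.mp <| by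
    linarith [hsq (Bᵀ *ᵥ (X *ᵥ (A *ᵥ a))), hsq (Bᵀ *ᵥ (X *ᵥ (A *ᵥ b)))]
  have hAa : A *ᵥ a = c.re • a - c.im • b := by rw [← ha, hfb, hua, mulVec_zero, sub_zero]
  have hAb : A *ᵥ b = c.im • a + c.re • b := by rw [← hb, hfb, hub, mulVec_zero, sub_zero]
  have hCa := hXAx a
  have hCb := hXAx b
  rw [hAa] at hua hCa
  rw [hAb] at hub hCb
  simp only [mulVec_sub, mulVec_add, mulVec_smul] at hua hub hCa hCb
  set p := X *ᵥ a with hp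
  set q := X *ᵥ b with hq
  have hr0 : c.re ^ 2 + c.im ^ 2 ≠ 0 := by linarith
  have solve {k : ℕ} {x y f g : Fin k → ℝ} (h1 : c.re • x - c.im • y = f)
      (h2 : c.im • x + c.re • y = g) :
      x = (c.re / (c.re ^ 2 + c.im ^ 2)) • f + (c.im / (c.re ^ 2 + c.im ^ 2)) • g ∧
      y = (-c.im / (c.re ^ 2 + c.im ^ 2)) • f + (c.re / (c.re ^ 2 + c.im ^ 2)) • g := by
    subst h1 h2
    constructor <;> ext i <;> simp <;> field_simp <;> ring
  obtain ⟨hBp, hBq⟩ := solve hua hub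
  obtain ⟨hAp, hAq⟩ := solve hCa hCb
  simp only [smul_zero, add_zero] at hBp hBq
  have hker := mulVec_pow_eq_zero_of_invariant_pair hAp hAq hBp hBq
  have hp0 : p = 0 := hreach p fun k => (hker k).1
  have hq0 : q = 0 := hreach q fun k => (hker k).2
  have hinj {x : Fin n → ℝ} (hx : X *ᵥ x = 0) : x = 0 := by
    by_contra hne
    simpa [hx] using hX.dotProduct_mulVec_pos hne
  exact hab.elim (· (hinj hp0)) (· (hinj hq0))
end

section
/- Let A ∈ ℝ^{n×n} have all its complex eigenvalues of modulus 1 and let B ∈ ℝ^{n×m} with (A,B) reachable. Then for every γ > 1 there exist ε_γ > 0 and a symmetric positive definite X ∈ ℝ^{n×n} satisfying the algebraic Riccati equation X = AᵀX[I_n + (1 − γ^{−2})BBᵀX]^{−1}A + ε_γ I_n, with γ²I_m − BᵀXB positive definite, such that, setting F = [I_m + (1 − γ^{−2})BᵀXB]^{−1}BᵀXA, the matrix A − BF is Schur stable and there exists δ with 0 < δ < γ such that for every z ∈ ℂ with |z| > 1 the Hermitian matrix δ²I_m − T_F(z)*T_F(z) is positive semidefinite, where T_F(z) = F(zI − A +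 BF)^{−1}B (i.e., ‖T_F‖_{H∞} < γ). -/
open Matrix
open scoped ComplexOrder

theorem exists_smul_one_sub_posSemidef {ι : Type*} [Fintype ι] [DecidableEq ι]
    {H : Matrix ι ι ℝ} (hH : H.IsHermitian) :
    ∃ c : ℝ, 0 < c ∧ (c • (1 : Matrix ι ι ℝ) - H).PosSemidef := by
  refine ⟨1 + ∑ i, ∑ j, |H i j|, by positivity, .of_dotProduct_mulVec_nonneg
    ((isHermitian_one.smul (IsSelfAdjoint.all _)).sub hH) fun x => ?_⟩
  have hle : ∀ i, x i ^ 2 ≤ x ⬝ᵥ x := fun i => by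
    rw [sq]
    exact Finset.single_le_sum (f := fun i => x i * x i) (fun i _ => mul_self_nonneg _)
      (Finset.mem_univ i)
  have hterm : ∀ i j, x i * (H i j * x j) ≤ |H i j| * (x ⬝ᵥ x) := fun i j => by
    have h1 : x i * x j ≤ x ⬝ᵥ x := by nlinarith [hle i, hle j, sq_nonneg (x i - x j)]
    have h2 : -(x i * x j) ≤ x ⬝ᵥ x := by nlinarith [hle i, hle j, sq_nonneg (x i + x j)]
    calc x i * (H i j * x j) = H i j * (x i * x j) := by ring
      _ ≤ |H i j * (x i * x j)| := le_abs_self _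
      _ = |H i j| * |x i * x j| := abs_mul _ _
      _ ≤ |H i j| * (x ⬝ᵥ x) := by gcongr; exact abs_le'.2 ⟨h1, h2⟩
  have hsum : x ⬝ᵥ (H *ᵥ x) ≤ (∑ i, ∑ j, |H i j|) * (x ⬝ᵥ x) := by
    have : x ⬝ᵥ (H *ᵥ x) = ∑ i, ∑ j, x i * (H i j * x j) := by
      simp only [dotProduct, mulVec, Finset.mul_sum]
    simp only [this, Finset.sum_mul]
    exact Finset.sum_le_sum fun i _ => Finset.sum_le_sum fun j _ => hterm i j
  have hx : 0 ≤ x ⬝ᵥ x := Finset.sum_nonneg fun i _ => mul_self_nonneg _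
  simp only [star_trivial, sub_mulVec, smul_mulVec, one_mulVec, dotProduct_sub, dotProduct_smul,
    smul_eq_mul]
  linarith

theorem inv_sub_inv_eq_conj {ι : Type*} [Fintype ι] [DecidableEq ι] {X Y : Matrix ι ι ℝ}
    (hX : X.PosDef) (hY : Y.PosDef) :
    X⁻¹ - Y⁻¹ = Y⁻¹ᴴ * (Y - X) * Y⁻¹ + ((Y - X) * Y⁻¹)ᴴ * X⁻¹ * ((Y - X) * Y⁻¹) := by
  have hX1 := mul_nonsing_inv X ((isUnit_iff_isUnit_det _).1 hX.isUnit)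
  have hX2 := nonsing_inv_mul X ((isUnit_iff_isUnit_det _).1 hX.isUnit)
  have hY1 := mul_nonsing_inv Y ((isUnit_iff_isUnit_det _).1 hY.isUnit)
  have hY2 := nonsing_inv_mul Y ((isUnit_iff_isUnit_det _).1 hY.isUnit)
  have e1 : X⁻¹ * ((Y - X) * Y⁻¹) = X⁻¹ - Y⁻¹ := by
    rw [sub_mul, hY1, mul_sub, mul_one, ← mul_assoc, hX2, one_mul]
  have e2 : Y⁻¹ * (Y - X) * X⁻¹ = X⁻¹ - Y⁻¹ := by
    rw [mul_sub, sub_mul, hY2, mul_assoc, hX1, mul_one, one_mul]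
  rw [conjTranspose_mul, hY.inv.isHermitian.eq, (hY.isHermitian.sub hX.isHermitian).eq, mul_assoc,
    mul_assoc _ (X⁻¹), e1, mul_sub, e2, mul_assoc]
  abel

theorem posSemidef_inv_sub_inv {ι : Type*} [Fintype ι] [DecidableEq ι] {X Y : Matrix ι ι ℝ}
    (hX : X.PosDef) (hXY : (Y - X).PosSemidef) : (X⁻¹ - Y⁻¹).PosSemidef := by
  have hY : Y.PosDef := by simpa using hX.add_posSemidef hXY
  rw [inv_sub_inv_eq_conj hX hY]
  exact (hXY.conjTranspose_mul_mul_same _).add (hX.inv.posSemidef.conjTranspose_mul_mul_same _)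

theorem posDef_inv_sub_inv {ι : Type*} [Fintype ι] [DecidableEq ι] {X Y : Matrix ι ι ℝ}
    (hX : X.PosDef) (hXY : (Y - X).PosDef) : (X⁻¹ - Y⁻¹).PosDef := by
  have hY : Y.PosDef := by simpa using hX.add hXY
  rw [inv_sub_inv_eq_conj hX hY]
  exact (hXY.conjTranspose_mul_mul_same
    (mulVec_injective_of_isUnit hY.inv.isUnit)).add_posSemidef
    (hX.inv.posSemidef.conjTranspose_mul_mul_same _)

theorem exists_sub_smul_one_posSemidef {ι : Type*} [Fintype ι] [DecidableEq ι]
    {P : Matrix ι ι ℝ} (hP : P.PosDef) :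
    ∃ ε : ℝ, 0 < ε ∧ (P - ε • (1 : Matrix ι ι ℝ)).PosSemidef := by
  obtain ⟨c, hc, h⟩ := exists_smul_one_sub_posSemidef hP.inv.isHermitian
  refine ⟨c⁻¹, inv_pos.2 hc, ?_⟩
  have := posSemidef_inv_sub_inv hP.inv h
  rwa [nonsing_inv_nonsing_inv _ ((isUnit_iff_isUnit_det _).1 hP.isUnit),
    show (c • (1 : Matrix ι ι ℝ))⁻¹ = c⁻¹ • 1 from inv_eq_left_inv (by simp [hc.ne'])] at this

open Filter Topology in
theorem exists_tendsto_of_posSemidef_sub {ι : Type*} [Fintype ι] [DecidableEq ι]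
    {X : ℕ → Matrix ι ι ℝ} {Y : Matrix ι ι ℝ} (hherm : ∀ k, (X k).IsHermitian)
    (hmono : ∀ k, (X (k + 1) - X k).PosSemidef) (hle : ∀ k, (Y - X k).PosSemidef) :
    ∃ L : Matrix ι ι ℝ, Tendsto X atTop (𝓝 L) := by
  have hq : ∀ v : ι → ℝ, ∃ l, Tendsto (fun k => v ⬝ᵥ (X k *ᵥ v)) atTop (𝓝 l) := fun v => by
    refine ⟨_, tendsto_atTop_ciSup (monotone_nat_of_le_succ fun k => ?_)
      ⟨v ⬝ᵥ (Y *ᵥ v), ?_⟩⟩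
    · simpa [sub_mulVec, dotProduct_sub] using (hmono k).dotProduct_mulVec_nonneg v
    · rintro _ ⟨k, rfl⟩
      simpa [sub_mulVec, dotProduct_sub] using (hle k).dotProduct_mulVec_nonneg v
  choose q hq using hq
  refine ⟨of fun i j =>
    (q (Pi.single i 1 + Pi.single j 1) - q (Pi.single i 1) - q (Pi.single j 1)) / 2, ?_⟩
  refine tendsto_pi_nhds.2 fun i => tendsto_pi_nhds.2 fun j => ?_
  refine ((((hq _).sub (hq (Pi.single i 1))).sub (hq (Pi.single j 1))).div_const 2).congr
    fun k => ?_
  have := (hherm k).apply i j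
  simp only [star_trivial] at this
  simp [mulVec_add, add_dotProduct, dotProduct_add, this]
  ring

open Filter Topology in
theorem tendsto_matrix_inv {ι α : Type*} [Fintype ι] [DecidableEq ι] {l : Filter α}
    {X : α → Matrix ι ι ℝ} {L : Matrix ι ι ℝ} (hX : Tendsto X l (𝓝 L)) (hL : IsUnit L) :
    Tendsto (fun a => (X a)⁻¹) l (𝓝 L⁻¹) := by
  refine (continuousAt_matrix_inv L ?_).tendsto.comp hX
  rw [Ring.inverse_eq_inv']
  exact continuousAt_inv₀ ((isUnit_iff_isUnit_det _).1 hL).ne_zero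

open Filter Topology in
theorem posSemidef_of_tendsto {ι α : Type*} [Fintype ι] {l : Filter α} [l.NeBot]
    {X : α → Matrix ι ι ℝ} {L : Matrix ι ι ℝ} (hX : Tendsto X l (𝓝 L))
    (h : ∀ a, (X a).PosSemidef) : L.PosSemidef := by
  refine .of_dotProduct_mulVec_nonneg ?_ fun v => ?_
  · refine tendsto_nhds_unique ((continuous_id.matrix_conjTranspose.tendsto L).comp hX)
      (hX.congr fun a => ((h a).isHermitian.eq).symm)
  · have hc : Continuous fun M : Matrix ι ι ℝ => star v ⬝ᵥ (M *ᵥ v) := by fun_prop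
    exact ge_of_tendsto' ((hc.tendsto L).comp hX) fun a => (h a).dotProduct_mulVec_nonneg v

open Filter Topology in
theorem exists_riccati_solution_le {ι : Type*} [Fintype ι] [DecidableEq ι]
    {A S Y : Matrix ι ι ℝ} {ε : ℝ} (hε : 0 < ε) (hS : S.PosSemidef) (hY : Y.PosDef)
    (hsuper : (Y - (Aᵀ * (Y⁻¹ + S)⁻¹ * A + ε • (1 : Matrix ι ι ℝ))).PosSemidef) :
    ∃ X : Matrix ι ι ℝ, X.PosDef ∧ (Y - X).PosSemidef ∧
      X = Aᵀ * (X⁻¹ + S)⁻¹ * A + ε • (1 : Matrix ι ι ℝ) := by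
  set g : Matrix ι ι ℝ → Matrix ι ι ℝ := fun X => Aᵀ * (X⁻¹ + S)⁻¹ * A + ε • 1 with hg
  replace hsuper : (Y - g Y).PosSemidef := hsuper
  have hone : (ε • (1 : Matrix ι ι ℝ)).PosDef := PosDef.one.smul hε
  have hT : Aᵀ = Aᴴ := (conjTranspose_eq_transpose_of_trivial A).symm
  have hlow : ∀ X : Matrix ι ι ℝ, X.PosDef → (g X - ε • 1).PosSemidef := fun X hX => by
    simp only [hg, add_sub_cancel_right, hT]
    exact (hX.inv.add_posSemidef hS).inv.posSemidef.conjTranspose_mul_mul_same A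
  have hmono : ∀ X Z : Matrix ι ι ℝ, X.PosDef → (Z - X).PosSemidef →
      (g Z - g X).PosSemidef := fun X Z hX hXZ => by
    have hZ : Z.PosDef := by simpa using hX.add_posSemidef hXZ
    have h1 : (X⁻¹ + S - (Z⁻¹ + S)).PosSemidef := by
      rw [add_sub_add_right_eq_sub]
      exact posSemidef_inv_sub_inv hX hXZ
    have h2 := (posSemidef_inv_sub_inv (hZ.inv.add_posSemidef hS) h1).conjTranspose_mul_mul_same A
    simpa only [hg, hT, add_sub_add_right_eq_sub, mul_sub, sub_mul] using h2
  let X : ℕ → Matrix ι ι ℝ := fun k => g^[k] (ε • 1)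
  have hsucc : ∀ k, X (k + 1) = g (X k) := fun k => Function.iterate_succ_apply' g k _
  have hXlow : ∀ k, (X k).PosDef ∧ (X k - ε • 1).PosSemidef := by
    intro k
    induction k with
    | zero => exact ⟨hone, by simpa [X] using PosSemidef.zero⟩
    | succ k ih =>
      have := hlow _ ih.1
      rw [hsucc]
      exact ⟨by simpa using hone.add_posSemidef this, this⟩
  have hXmono : ∀ k, (X (k + 1) - X k).PosSemidef := by
    intro k
    induction k with
    | zero => exact hlow _ hone
    | succ k ih =>
      rw [hsucc (k + 1)]
      nth_rw 2 [hsucc k]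
      exact hmono _ _ (hXlow k).1 ih
  have hXY : ∀ k, (Y - X k).PosSemidef := by
    intro k
    induction k with
    | zero =>
      change (Y - ε • 1).PosSemidef
      simpa only [sub_add_sub_cancel] using hsuper.add (hlow Y hY)
    | succ k ih =>
      rw [hsucc]
      simpa only [sub_add_sub_cancel] using hsuper.add (hmono _ _ (hXlow k).1 ih)
  obtain ⟨L, hL⟩ := exists_tendsto_of_posSemidef_sub (fun k => (hXlow k).1.isHermitian) hXmono hXY
  have hLpos : L.PosDef := by
    simpa using hone.add_posSemidef
      (posSemidef_of_tendsto (hL.sub_const (ε • 1)) fun k => (hXlow k).2)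
  refine ⟨L, hLpos, posSemidef_of_tendsto (hL.const_sub Y) hXY, ?_⟩
  refine tendsto_nhds_unique (hL.comp (tendsto_add_atTop_nat 1)) ?_
  have hin := tendsto_matrix_inv ((tendsto_matrix_inv hL hLpos.isUnit).add_const S)
    (hLpos.inv.add_posSemidef hS).isUnit
  exact (((hin.const_mul Aᵀ).mul_const A).add_const (ε • 1)).congr fun k => (hsucc k).symm

theorem re_map_ofReal_mulVec {ι κ : Type*} [Fintype κ] (M : Matrix ι κ ℝ) (x : κ → ℂ) (i : ι) :
    ((M.map Complex.ofReal *ᵥ x) i).re = (M *ᵥ fun j => (x j).re) i := by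
  simp [mulVec, dotProduct]

theorem im_map_ofReal_mulVec {ι κ : Type*} [Fintype κ] (M : Matrix ι κ ℝ) (x : κ → ℂ) (i : ι) :
    ((M.map Complex.ofReal *ᵥ x) i).im = (M *ᵥ fun j => (x j).im) i := by
  simp [mulVec, dotProduct]

theorem map_ofReal_mulVec_ofReal {ι κ : Type*} [Fintype κ] (M : Matrix ι κ ℝ) (x : κ → ℝ) :
    (M.map Complex.ofReal *ᵥ fun j => (x j : ℂ)) = fun i => ((M *ᵥ x) i : ℂ) := by
  ext i
  simp [mulVec, dotProduct]

theorem mem_spectrum_iff_exists_mulVec {ι : Type*} [Fintype ι] [DecidableEq ι]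
    {M : Matrix ι ι ℂ} {c : ℂ} :
    c ∈ spectrum ℂ M ↔ ∃ u, u ≠ 0 ∧ M *ᵥ u = c • u := by
  rw [← Matrix.spectrum_toLin', ← Module.End.hasEigenvalue_iff_mem_spectrum]
  constructor
  · intro h
    obtain ⟨u, hu⟩ := h.exists_hasEigenvector
    exact ⟨u, hu.2, by simpa using hu.apply_eq_smul⟩
  · rintro ⟨u, hu, h⟩
    exact Module.End.hasEigenvalue_of_hasEigenvector
      (Module.End.hasEigenvector_iff.2 ⟨Module.End.mem_eigenspace_iff.2 (by simpa using h), hu⟩)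

theorem mem_spectrum_transpose {ι : Type*} [Fintype ι] [DecidableEq ι] {M : Matrix ι ι ℂ} {c : ℂ}
    (h : c ∈ spectrum ℂ Mᵀ) : c ∈ spectrum ℂ M := by
  rw [spectrum.mem_iff] at h ⊢
  contrapose! h
  have := (isUnit_transpose (A := algebraMap ℂ (Matrix ι ι ℂ) c - M)).2 h
  simpa [Matrix.algebraMap_eq_diagonal] using this

theorem eq_zero_of_reachable_complex {n m : ℕ} {A : Matrix (Fin n) (Fin n) ℝ}
    {B : Matrix (Fin n) (Fin m) ℝ}
    (hreach : ∀ w : Fin n → ℝ, (∀ k : ℕ, Bᵀ *ᵥ ((Aᵀ) ^ k *ᵥ w) = 0) → w = 0)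
    {u : Fin n → ℂ}
    (hu : ∀ k : ℕ, Bᵀ.map Complex.ofReal *ᵥ ((Aᵀ.map Complex.ofReal) ^ k *ᵥ u) = 0) : u = 0 := by
  have hpow : ∀ k : ℕ, (Aᵀ.map Complex.ofReal) ^ k = (Aᵀ ^ k).map Complex.ofReal := fun k =>
    (map_pow (Complex.ofRealHom.mapMatrix) Aᵀ k).symm
  have hre : (fun j => (u j).re) = 0 := hreach _ fun k => by
    ext i
    have := congrArg Complex.re (congrFun (hu k) i)
    rwa [re_map_ofReal_mulVec, hpow, funext (re_map_ofReal_mulVec _ u)] at this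
  have him : (fun j => (u j).im) = 0 := hreach _ fun k => by
    ext i
    have := congrArg Complex.im (congrFun (hu k) i)
    rwa [im_map_ofReal_mulVec, hpow, funext (im_map_ofReal_mulVec _ u)] at this
  ext j
  exact Complex.ext (congrFun hre j) (congrFun him j)

open Filter Topology in
theorem not_tendsto_zero_of_reachable {n m : ℕ} {A : Matrix (Fin n) (Fin n) ℝ}
    {B : Matrix (Fin n) (Fin m) ℝ}
    (hspec : ∀ c ∈ spectrum ℂ (A.map Complex.ofReal), ‖c‖ = 1)
    (hreach : ∀ w : Fin n → ℝ, (∀ k : ℕ, Bᵀ *ᵥ ((Aᵀ) ^ k *ᵥ w) = 0) → w = 0)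
    (hA : IsUnit A) {v : Fin n → ℝ}
    (h : Tendsto (fun k : ℕ => Bᵀ *ᵥ ((Aᵀ⁻¹) ^ k *ᵥ v)) atTop (𝓝 0)) : v = 0 := by
  set Ac : Matrix (Fin n) (Fin n) ℂ := Aᵀ.map Complex.ofReal with hAc
  set Mc : Matrix (Fin n) (Fin n) ℂ := Aᵀ⁻¹.map Complex.ofReal with hMc
  set Bc : Matrix (Fin m) (Fin n) ℂ := Bᵀ.map Complex.ofReal with hBc
  have hMA : Mc * Ac = 1 := by
    have : Aᵀ⁻¹ * Aᵀ = 1 := nonsing_inv_mul _ ((isUnit_iff_isUnit_det _).1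
      ((isUnit_transpose (A := A)).2 hA))
    have := congrArg (Complex.ofRealHom.mapMatrix) this
    rwa [map_mul, map_one] at this
  let E : Submodule ℂ (Fin n → ℂ) :=
    { carrier := {u | Tendsto (fun k : ℕ => Bc *ᵥ (Mc ^ k *ᵥ u)) atTop (𝓝 0)}
      zero_mem' := by simp
      add_mem' := fun {a b} ha hb => by simpa [mulVec_add] using ha.add hb
      smul_mem' := fun c u hu => by simpa [mulVec_smul] using hu.const_smul c }
  have hAE : ∀ u ∈ E, toLin' Ac u ∈ E := fun u hu => by
    refine (tendsto_add_atTop_iff_nat 1).1 (hu.congr fun k => ?_)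
    simp [mulVec_mulVec, pow_succ, mul_assoc, hMA]
  have hvE : (fun j => (v j : ℂ)) ∈ E := by
    have hpow : ∀ k : ℕ, Mc ^ k = (Aᵀ⁻¹ ^ k).map Complex.ofReal := fun k =>
      (map_pow (Complex.ofRealHom.mapMatrix) Aᵀ⁻¹ k).symm
    refine tendsto_pi_nhds.2 fun i => ?_
    simp only [hpow, hBc, map_ofReal_mulVec_ofReal]
    simpa [Function.comp_def] using
      (Complex.continuous_ofReal.tendsto _).comp (tendsto_pi_nhds.1 h i)
  have hE : E = ⊥ := by
    by_contra hE
    have := Submodule.nontrivial_iff_ne_bot.2 hE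
    obtain ⟨c, hc⟩ := Module.End.exists_eigenvalue ((toLin' Ac).restrict hAE)
    obtain ⟨u, hu⟩ := hc.exists_hasEigenvector
    have hu0 : (u : Fin n → ℂ) ≠ 0 := fun h => hu.2 (Subtype.ext h)
    have huc : Ac *ᵥ u = c • (u : Fin n → ℂ) := by
      simpa using congrArg Subtype.val hu.apply_eq_smul
    have hc1 : ‖c‖ = 1 :=
      hspec c (mem_spectrum_transpose (mem_spectrum_iff_exists_mulVec.2 ⟨u, hu0, huc⟩))
    have hMu : ∀ k : ℕ, c ^ k • (Mc ^ k *ᵥ (u : Fin n → ℂ)) = u := by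
      intro k
      induction k with
      | zero => simp
      | succ k ih =>
        rw [pow_succ c, pow_succ Mc, mul_smul, ← mulVec_smul, ← huc, mulVec_mulVec, mul_assoc,
          hMA, mul_one, ih]
    have hBu : Bc *ᵥ (u : Fin n → ℂ) = 0 := by
      have hlim : Tendsto (fun k : ℕ => Bc *ᵥ (Mc ^ k *ᵥ (u : Fin n → ℂ))) atTop (𝓝 0) := u.2
      refine norm_eq_zero.1 (tendsto_nhds_unique (tendsto_const_nhds (f := (atTop : Filter ℕ)))
        ((tendsto_norm_zero.comp hlim).congr fun k => ?_))
      conv_rhs => rw [← hMu k, mulVec_smul, norm_smul, norm_pow, hc1, one_pow, one_mul]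
      rfl
    refine hu0 (eq_zero_of_reachable_complex hreach fun k => ?_)
    have : ∀ k : ℕ, Ac ^ k *ᵥ (u : Fin n → ℂ) = c ^ k • (u : Fin n → ℂ) := by
      intro k
      induction k with
      | zero => simp
      | succ k ih => rw [pow_succ, ← mulVec_mulVec, huc, mulVec_smul, ih, smul_smul, pow_succ']
    rw [this, mulVec_smul, hBu, smul_zero]
  rw [hE] at hvE
  ext j
  simpa using congrFun ((Submodule.mem_bot ℂ).1 hvE) j

theorem isUnit_of_spectrum_map_ofReal_norm_eq_one {n : ℕ} {A : Matrix (Fin n) (Fin n) ℝ}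
    (hspec : ∀ c ∈ spectrum ℂ (A.map Complex.ofReal), ‖c‖ = 1) : IsUnit A := by
  by_contra hA
  have h0 : (0 : ℂ) ∈ spectrum ℂ (A.map Complex.ofReal) := by
    rw [spectrum.zero_mem_iff, isUnit_iff_isUnit_det]
    rw [isUnit_iff_isUnit_det, isUnit_iff_ne_zero, not_not] at hA
    have : (A.map Complex.ofReal).det = 0 := by
      have := (Complex.ofRealHom.map_det A).symm
      rwa [hA, map_zero] at this
    simp [this]
  simpa using hspec 0 h0

theorem dotProduct_gram_mulVec {ι κ : Type*} [Fintype ι] [Fintype κ] (G : Matrix ι κ ℝ)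
    (v : ι → ℝ) : v ⬝ᵥ ((G * Gᵀ) *ᵥ v) = (Gᵀ *ᵥ v) ⬝ᵥ (Gᵀ *ᵥ v) := by
  rw [← mulVec_mulVec, dotProduct_mulVec, mulVec_transpose]

open Filter Topology in
theorem tendsto_zero_of_sum_dotProduct_self_le {κ : Type*} [Fintype κ] {f : ℕ → κ → ℝ} {C : ℝ}
    (h : ∀ N, ∑ k ∈ Finset.range N, f k ⬝ᵥ f k ≤ C) : Tendsto f atTop (𝓝 0) := by
  have h0 := (summable_of_sum_range_le (fun k => Finset.sum_nonneg fun i _ =>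
    mul_self_nonneg (f k i)) h).tendsto_atTop_zero
  refine tendsto_pi_nhds.2 fun i => ?_
  have hsq : Tendsto (fun k => f k i * f k i) atTop (𝓝 0) :=
    squeeze_zero (fun k => mul_self_nonneg _) (fun k => Finset.single_le_sum
      (f := fun i => f k i * f k i) (fun i _ => mul_self_nonneg _) (Finset.mem_univ i)) h0
  have := (Real.continuous_sqrt.tendsto 0).comp hsq
  simp only [Function.comp_def, Real.sqrt_mul_self_eq_abs, Real.sqrt_zero] at this
  exact (tendsto_zero_iff_abs_tendsto_zero _).2 this

theorem exists_sum_sub_smul_one_posSemidef {ι : Type*} [Fintype ι] [DecidableEq ι]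
    {P : ℕ → Matrix ι ι ℝ} (hP : ∀ k, (P k).PosSemidef)
    (hdiv : ∀ v : ι → ℝ, v ≠ 0 → ∀ C, ∃ N, C < ∑ k ∈ Finset.range N, v ⬝ᵥ (P k *ᵥ v)) (c : ℝ) :
    ∃ N, (∑ k ∈ Finset.range N, P k - c • (1 : Matrix ι ι ℝ)).PosSemidef := by
  let U : ℕ → Set (ι → ℝ) := fun N =>
    {v | c * (v ⬝ᵥ v) < ∑ k ∈ Finset.range N, v ⬝ᵥ (P k *ᵥ v)}
  have hmono : Monotone U := monotone_nat_of_le_succ fun N v hv => by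
    simp only [U, Set.mem_ofPred_eq] at hv ⊢
    have := (hP N).dotProduct_mulVec_nonneg v
    simp only [star_trivial] at this
    rw [Finset.sum_range_succ]
    linarith
  obtain ⟨N, hN⟩ := (isCompact_sphere (0 : ι → ℝ) 1).elim_directed_cover U
    (fun N => isOpen_lt (by fun_prop) (by fun_prop))
    (fun v hv => Set.mem_iUnion.2 (hdiv v (ne_zero_of_mem_unit_sphere ⟨v, hv⟩) _))
    hmono.directed_le
  refine ⟨N, .of_dotProduct_mulVec_nonneg ((posSemidef_sum _ fun k _ => hP k).isHermitian.sub
    (isHermitian_one.smul (IsSelfAdjoint.all _))) fun v => ?_⟩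
  rcases eq_or_ne v 0 with rfl | hv
  · simp
  have hv0 : 0 < ‖v‖ := norm_pos_iff.2 hv
  have hmem : ‖v‖⁻¹ • v ∈ U N := hN (by simp [norm_smul, hv0.ne'])
  simp only [U, Set.mem_ofPred_eq, mulVec_smul, dotProduct_smul, smul_dotProduct, smul_eq_mul,
    ← Finset.mul_sum] at hmem
  have h2 : ‖v‖⁻¹ * (‖v‖⁻¹ * (c * (v ⬝ᵥ v))) <
      ‖v‖⁻¹ * (‖v‖⁻¹ * ∑ k ∈ Finset.range N, v ⬝ᵥ (P k *ᵥ v)) := by linarith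
  have h3 := lt_of_mul_lt_mul_left (lt_of_mul_lt_mul_left h2 (by positivity)) (by positivity)
  simp only [star_trivial, sub_mulVec, smul_mulVec, one_mulVec, dotProduct_sub, dotProduct_smul,
    smul_eq_mul, sum_mulVec, dotProduct_sum]
  linarith

theorem exists_large_lyapunov {n m : ℕ} {A : Matrix (Fin n) (Fin n) ℝ}
    {B : Matrix (Fin n) (Fin m) ℝ}
    (hspec : ∀ c ∈ spectrum ℂ (A.map Complex.ofReal), ‖c‖ = 1)
    (hreach : ∀ w : Fin n → ℝ, (∀ k : ℕ, Bᵀ *ᵥ ((Aᵀ) ^ k *ᵥ w) = 0) → w = 0)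
    (hA : IsUnit A) {c : ℝ} (hc : 0 < c) :
    ∃ W : Matrix (Fin n) (Fin n) ℝ, (W - c • (1 : Matrix (Fin n) (Fin n) ℝ)).PosSemidef ∧
      (W + B * Bᵀ - A * W * Aᵀ).PosDef := by
  have hAA : A * A⁻¹ = 1 := mul_nonsing_inv _ ((isUnit_iff_isUnit_det _).1 hA)
  let P : ℕ → Matrix (Fin n) (Fin n) ℝ := fun k => (A⁻¹ ^ k * B) * (A⁻¹ ^ k * B)ᵀ
  have hP : ∀ k, (P k).PosSemidef := fun k => by
    simpa [P, conjTranspose_eq_transpose_of_trivial] using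
      posSemidef_self_mul_conjTranspose (A⁻¹ ^ k * B)
  have hAP : ∀ k, A * P (k + 1) * Aᵀ = P k := fun k => by
    have : A * (A⁻¹ ^ (k + 1) * B) = A⁻¹ ^ k * B := by
      rw [pow_succ', ← Matrix.mul_assoc, ← mul_assoc, hAA, one_mul]
    simp only [P]
    rw [← this, transpose_mul A]
    simp only [Matrix.mul_assoc]
  have hdiv : ∀ v : Fin n → ℝ, v ≠ 0 → ∀ C,
      ∃ N, C < ∑ k ∈ Finset.range N, v ⬝ᵥ (P (k + 1) *ᵥ v) := fun v hv C => by
    by_contra! hle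
    simp only [P, dotProduct_gram_mulVec] at hle
    refine hv (not_tendsto_zero_of_reachable hspec hreach hA ((Filter.tendsto_add_atTop_iff_nat 1).1
      ((tendsto_zero_of_sum_dotProduct_self_le hle).congr fun k => ?_)))
    rw [transpose_mul, transpose_pow, transpose_nonsing_inv, mulVec_mulVec]
  obtain ⟨N, hN⟩ := exists_sum_sub_smul_one_posSemidef (fun k => hP (k + 1)) hdiv (2 * c)
  set L : ℕ := 2 * N + 1 with hL
  have hL0 : (0 : ℝ) < L := by positivity
  let d : ℕ → ℝ := fun j => (L - j) / L
  let W := ∑ k ∈ Finset.range L, d (k + 1) • P (k + 1)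
  have hW : W + B * Bᵀ = ∑ k ∈ Finset.range L, d k • P k := by
    have h1 := Finset.sum_range_succ' (fun k => d k • P k) L
    have h2 := Finset.sum_range_succ (fun k => d k • P k) L
    have hd0 : d 0 = 1 := by simp [d, hL0.ne']
    have hdL : d L = 0 := by simp [d]
    have hP0 : P 0 = B * Bᵀ := by simp [P]
    rw [hd0, one_smul, hP0] at h1
    rw [hdL, zero_smul, add_zero] at h2
    exact h1.symm.trans h2
  have hAW : A * W * Aᵀ = ∑ k ∈ Finset.range L, d (k + 1) • P k := by
    simp only [W, Finset.mul_sum, Finset.sum_mul, mul_smul_comm, smul_mul_assoc, hAP]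
  refine ⟨W, ?_, ?_⟩
  · have hsplit : W - c • 1 = (2⁻¹ : ℝ) • (∑ k ∈ Finset.range N, P (k + 1) - (2 * c) • 1) +
        (∑ k ∈ Finset.range N, (d (k + 1) - 2⁻¹) • P (k + 1) +
          ∑ k ∈ Finset.Ico N L, d (k + 1) • P (k + 1)) := by
      have h1 := Finset.sum_range_add_sum_Ico (fun k => d (k + 1) • P (k + 1))
        (show N ≤ L by omega)
      simp only [W]
      rw [← h1, smul_sub, smul_smul, inv_mul_cancel_left₀ two_ne_zero]
      simp only [sub_smul, Finset.sum_sub_distrib, ← Finset.smul_sum]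
      abel
    rw [hsplit]
    refine (hN.smul (by norm_num)).add ((posSemidef_sum _ fun k hk => (hP _).smul ?_).add
      (posSemidef_sum _ fun k hk => (hP _).smul ?_))
    · have : (k : ℝ) + 1 ≤ N := by exact_mod_cast Finset.mem_range.1 hk
      rw [sub_nonneg, le_div_iff₀ hL0]
      push_cast [hL]
      linarith
    · have : (k : ℝ) + 1 ≤ L := by exact_mod_cast (Finset.mem_Ico.1 hk).2
      exact div_nonneg (by push_cast; linarith) hL0.le
  · have hsplit : W + B * Bᵀ - A * W * Aᵀ = (L : ℝ)⁻¹ • ((2 * c) • 1 +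
        ((∑ k ∈ Finset.range N, P (k + 1) - (2 * c) • 1) +
          (P 0 + ∑ k ∈ Finset.Ico (N + 1) L, P k))) := by
      have h1 := Finset.sum_range_add_sum_Ico P (show N + 1 ≤ L by omega)
      rw [Finset.sum_range_succ'] at h1
      have h2 : ∀ k, d k - d (k + 1) = (L : ℝ)⁻¹ := fun k => by
        simp only [d]
        field_simp
        push_cast
        ring
      rw [hW, hAW, ← Finset.sum_sub_distrib]
      simp only [← sub_smul, h2, ← Finset.smul_sum]
      rw [← h1]
      congr 1
      abel
    rw [hsplit]
    exact ((PosDef.one.smul (by linarith)).add_posSemidef (hN.add ((hP 0).add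
      (posSemidef_sum _ fun k _ => hP k)))).smul (inv_pos.2 hL0)

theorem exists_small_riccati_solution {n m : ℕ} {A : Matrix (Fin n) (Fin n) ℝ}
    {B : Matrix (Fin n) (Fin m) ℝ}
    (hspec : ∀ c ∈ spectrum ℂ (A.map Complex.ofReal), ‖c‖ = 1)
    (hreach : ∀ w : Fin n → ℝ, (∀ k : ℕ, Bᵀ *ᵥ ((Aᵀ) ^ k *ᵥ w) = 0) → w = 0)
    {β g : ℝ} (hβ : 0 < β) (hg : 1 < g) :
    ∃ (ε : ℝ) (X : Matrix (Fin n) (Fin n) ℝ), 0 < ε ∧ X.PosDef ∧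
      X = Aᵀ * (X⁻¹ + β • (B * Bᵀ))⁻¹ * A + ε • (1 : Matrix (Fin n) (Fin n) ℝ) ∧
      (g • (1 : Matrix (Fin m) (Fin m) ℝ) - Bᵀ * X * B).PosDef := by
  have hA : IsUnit A := isUnit_of_spectrum_map_ofReal_norm_eq_one hspec
  have hAd := (isUnit_iff_isUnit_det _).1 hA
  have hBT : Bᵀ = Bᴴ := (conjTranspose_eq_transpose_of_trivial B).symm
  have hAT : Aᵀ = Aᴴ := (conjTranspose_eq_transpose_of_trivial A).symm
  obtain ⟨b, hb, hbB⟩ := exists_smul_one_sub_posSemidef (isHermitian_conjTranspose_mul_self B)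
  obtain ⟨W₀, hW₀, hlyap₀⟩ := exists_large_lyapunov hspec hreach hA (div_pos hb hβ)
  set S := β • (B * Bᵀ) with hS_def
  have hS : S.PosSemidef := by
    rw [hS_def, hBT]
    exact (posSemidef_self_mul_conjTranspose B).smul hβ.le
  set W := β • W₀ with hW_def
  have hWb : (W - b • 1).PosSemidef := by
    have := hW₀.smul hβ.le
    rwa [smul_sub, smul_smul, mul_div_cancel₀ _ hβ.ne'] at this
  have hlyap : (W + S - A * W * Aᵀ).PosDef := by
    have := hlyap₀.smul hβ
    rwa [smul_sub, smul_add, ← smul_mul_assoc, ← mul_smul_comm] at this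
  have hbpos : (b • (1 : Matrix (Fin n) (Fin n) ℝ)).PosDef := PosDef.one.smul hb
  have hW : W.PosDef := by simpa using hbpos.add_posSemidef hWb
  have hAWA : (A * W * Aᵀ).PosDef := by
    rw [hAT]
    exact hW.mul_mul_conjTranspose_same (vecMul_injective_of_isUnit hA)
  have hinv : Aᵀ * (A * W * Aᵀ)⁻¹ * A = W⁻¹ := by
    have hAtd : IsUnit Aᵀ.det := by rwa [det_transpose]
    rw [Matrix.mul_inv_rev, Matrix.mul_inv_rev, mul_nonsing_inv_cancel_left _ _ hAtd,
      nonsing_inv_mul_cancel_right _ _ hAd]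
  have hstrict : (W⁻¹ - Aᵀ * (W + S)⁻¹ * A).PosDef := by
    have := (posDef_inv_sub_inv hAWA hlyap).conjTranspose_mul_mul_same
      (mulVec_injective_of_isUnit hA)
    rwa [← hAT, mul_sub, sub_mul, hinv] at this
  obtain ⟨ε, hε, hεP⟩ := exists_sub_smul_one_posSemidef hstrict
  obtain ⟨X, hX, hXW, hric⟩ := exists_riccati_solution_le (A := A) hε hS hW.inv (by
    rwa [nonsing_inv_nonsing_inv _ ((isUnit_iff_isUnit_det _).1 hW.isUnit), ← sub_sub])
  refine ⟨ε, X, hε, hX, hric, ?_⟩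
  have hWinv := posSemidef_inv_sub_inv hbpos hWb
  rw [show (b • (1 : Matrix (Fin n) (Fin n) ℝ))⁻¹ = b⁻¹ • 1 from
    inv_eq_left_inv (by simp [hb.ne'])] at hWinv
  have hsplit : g • (1 : Matrix (Fin m) (Fin m) ℝ) - Bᵀ * X * B = (g - 1) • 1 +
      (b⁻¹ • (b • 1 - Bᴴ * B) + (Bᴴ * (b⁻¹ • 1 - W⁻¹) * B + Bᴴ * (W⁻¹ - X) * B)) := by
    rw [hBT]
    simp only [smul_sub, smul_smul, inv_mul_cancel₀ hb.ne', sub_smul, one_smul,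
      Matrix.mul_smul, Matrix.smul_mul, Matrix.mul_sub,
      Matrix.sub_mul, Matrix.mul_one]
    abel
  rw [hsplit]
  exact (PosDef.one.smul (sub_pos.2 hg)).add_posSemidef ((hbB.smul (inv_pos.2 hb).le).add
    ((hWinv.conjTranspose_mul_mul_same B).add (hXW.conjTranspose_mul_mul_same B)))

theorem riccati_dissipation {n m : ℕ} {A X : Matrix (Fin n) (Fin n) ℝ}
    {B : Matrix (Fin n) (Fin m) ℝ} {γ ε : ℝ} (hγ : 1 < γ) (hX : X.PosDef)
    (hunit : IsUnit ((1 : Matrix (Fin n) (Fin n) ℝ) + (1 - γ⁻¹ ^ 2) • (B * Bᵀ * X)))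
    (hric : X = Aᵀ * X *
      ((1 : Matrix (Fin n) (Fin n) ℝ) + (1 - γ⁻¹ ^ 2) • (B * Bᵀ * X))⁻¹ * A
        + ε • (1 : Matrix (Fin n) (Fin n) ℝ))
    (hBXB : (γ ^ 2 • (1 : Matrix (Fin m) (Fin m) ℝ) - Bᵀ * X * B).PosSemidef)
    {F : Matrix (Fin m) (Fin n) ℝ}
    (hF : F = ((1 : Matrix (Fin m) (Fin m) ℝ) + (1 - γ⁻¹ ^ 2) • (Bᵀ * X * B))⁻¹ *
      (Bᵀ * X * A)) (x : Fin n → ℝ) (w : Fin m → ℝ) :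
    ε * (x ⬝ᵥ x) + (F *ᵥ x) ⬝ᵥ (F *ᵥ x) +
      ((A - B * F) *ᵥ x + B *ᵥ w) ⬝ᵥ (X *ᵥ ((A - B * F) *ᵥ x + B *ᵥ w)) ≤
      x ⬝ᵥ (X *ᵥ x) + γ ^ 2 * (w ⬝ᵥ w) := by
  have hβ : 0 < 1 - γ⁻¹ ^ 2 := by
    have : γ⁻¹ < 1 := inv_lt_one_of_one_lt₀ hγ
    have : 0 < γ⁻¹ := by positivity
    nlinarith
  have hBT : Bᵀ = Bᴴ := (conjTranspose_eq_transpose_of_trivial B).symm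
  have hXT : Xᵀ = X := by simpa using hX.isHermitian.eq
  have hsymm : ∀ u v : Fin n → ℝ, u ⬝ᵥ (X *ᵥ v) = v ⬝ᵥ (X *ᵥ u) := fun u v => by
    rw [dotProduct_mulVec, ← mulVec_transpose, hXT, dotProduct_comm]
  have hB : ∀ (u : Fin m → ℝ) (v : Fin n → ℝ), (B *ᵥ u) ⬝ᵥ v = u ⬝ᵥ (Bᵀ *ᵥ v) := fun u v => by
    rw [dotProduct_mulVec, vecMul_transpose]
  set β := 1 - γ⁻¹ ^ 2 with hβ_def
  set R := (1 : Matrix (Fin n) (Fin n) ℝ) + β • (B * Bᵀ * X) with hR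
  have hm : ((1 : Matrix (Fin m) (Fin m) ℝ) + β • (Bᵀ * X * B)).PosDef := by
    rw [hBT]
    exact PosDef.one.add_posSemidef ((hX.posSemidef.conjTranspose_mul_mul_same B).smul hβ.le)
  let y := R⁻¹ *ᵥ (A *ᵥ x)
  let p := Bᵀ *ᵥ (X *ᵥ y)
  have hAx : A *ᵥ x = y + β • (B *ᵥ p) := by
    have : R *ᵥ y = A *ᵥ x := by
      rw [mulVec_mulVec, mul_nonsing_inv _ ((isUnit_iff_isUnit_det _).1 hunit), one_mulVec]
    rw [← this, hR, add_mulVec, one_mulVec, smul_mulVec]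
    simp only [p, mulVec_mulVec, Matrix.mul_assoc]
  have hFx : F *ᵥ x = p := by
    have : (Bᵀ * X * A) *ᵥ x = (1 + β • (Bᵀ * X * B)) *ᵥ p := by
      rw [← mulVec_mulVec, hAx, mulVec_add, mulVec_smul, add_mulVec, one_mulVec, smul_mulVec]
      simp only [p, mulVec_mulVec, Matrix.mul_assoc]
    rw [hF, ← mulVec_mulVec, this, mulVec_mulVec,
      nonsing_inv_mul _ ((isUnit_iff_isUnit_det _).1 hm.isUnit), one_mulVec]
  have hnext : (A - B * F) *ᵥ x + B *ᵥ w = y + B *ᵥ (w - γ⁻¹ ^ 2 • p) := by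
    rw [sub_mulVec, ← mulVec_mulVec, hFx, hAx, mulVec_sub, mulVec_smul, hβ_def, sub_smul, one_smul]
    abel
  have hxX : x ⬝ᵥ (X *ᵥ x) = (A *ᵥ x) ⬝ᵥ (X *ᵥ y) + ε * (x ⬝ᵥ x) := by
    conv_lhs => rw [hric]
    rw [add_mulVec, dotProduct_add, smul_mulVec, one_mulVec, dotProduct_smul, smul_eq_mul,
      Matrix.mul_assoc, Matrix.mul_assoc, ← mulVec_mulVec, dotProduct_mulVec, vecMul_transpose]
    simp only [y, mulVec_mulVec]
  have hgap := hBXB.dotProduct_mulVec_nonneg (w - γ⁻¹ ^ 2 • p)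
  rw [star_trivial, sub_mulVec, dotProduct_sub, smul_mulVec, one_mulVec, dotProduct_smul,
    smul_eq_mul, Matrix.mul_assoc, ← mulVec_mulVec, ← hB, ← mulVec_mulVec] at hgap
  have hww : γ ^ 2 * ((w - γ⁻¹ ^ 2 • p) ⬝ᵥ (w - γ⁻¹ ^ 2 • p)) =
      γ ^ 2 * (w ⬝ᵥ w) - 2 * (w ⬝ᵥ p) + γ⁻¹ ^ 2 * (p ⬝ᵥ p) := by
    simp only [sub_dotProduct, dotProduct_sub, smul_dotProduct, dotProduct_smul, smul_eq_mul,
      dotProduct_comm p w]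
    field_simp
    ring
  have hcross : (B *ᵥ (w - γ⁻¹ ^ 2 • p)) ⬝ᵥ (X *ᵥ y) = w ⬝ᵥ p - γ⁻¹ ^ 2 * (p ⬝ᵥ p) := by
    rw [hB, sub_dotProduct, smul_dotProduct, smul_eq_mul]
  have hBp : (B *ᵥ p) ⬝ᵥ (X *ᵥ y) = p ⬝ᵥ p := hB _ _
  rw [hnext, hFx, hxX, hAx]
  simp only [mulVec_add, add_dotProduct, dotProduct_add, smul_dotProduct, smul_eq_mul, hBp,
    hsymm y, hcross]
  linarith

theorem star_dotProduct_self_complex {ι : Type*} [Fintype ι] (u : ι → ℂ) :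
    star u ⬝ᵥ u = ((∑ i, Complex.normSq (u i) : ℝ) : ℂ) := by
  simp [dotProduct, Complex.normSq_eq_conj_mul_self]

theorem sum_normSq_eq_dotProduct {ι : Type*} [Fintype ι] (u : ι → ℂ) :
    ∑ i, Complex.normSq (u i) =
      (fun i => (u i).re) ⬝ᵥ (fun i => (u i).re) + (fun i => (u i).im) ⬝ᵥ fun i => (u i).im := by
  simp [dotProduct, Complex.normSq_apply, Finset.sum_add_distrib]

theorem complex_dissipation {ι κ ν : Type*} [Fintype ι] [Fintype κ] [Fintype ν]
    {X K : Matrix ι ι ℝ} {B : Matrix ι κ ℝ} {F : Matrix ν ι ℝ} {ε g : ℝ} (hX : X.PosSemidef)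
    (h : ∀ x w, ε * (x ⬝ᵥ x) + (F *ᵥ x) ⬝ᵥ (F *ᵥ x) +
      (K *ᵥ x + B *ᵥ w) ⬝ᵥ (X *ᵥ (K *ᵥ x + B *ᵥ w)) ≤ x ⬝ᵥ (X *ᵥ x) + g * (w ⬝ᵥ w))
    {z : ℂ} (hz : 1 ≤ ‖z‖) {x : ι → ℂ} {w : κ → ℂ}
    (hxw : K.map Complex.ofReal *ᵥ x + B.map Complex.ofReal *ᵥ w = z • x) :
    ε * ∑ i, Complex.normSq (x i) + ∑ i, Complex.normSq ((F.map Complex.ofReal *ᵥ x) i) ≤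
      g * ∑ i, Complex.normSq (w i) := by
  simp only [sum_normSq_eq_dotProduct, re_map_ofReal_mulVec, im_map_ofReal_mulVec]
  have hre : K *ᵥ (fun i => (x i).re) + B *ᵥ (fun i => (w i).re) =
      z.re • (fun i => (x i).re) - z.im • fun i => (x i).im := by
    ext i
    simpa [re_map_ofReal_mulVec] using congrArg Complex.re (congrFun hxw i)
  have him : K *ᵥ (fun i => (x i).im) + B *ᵥ (fun i => (w i).im) =
      z.re • (fun i => (x i).im) + z.im • fun i => (x i).re := by
    ext i
    simpa [im_map_ofReal_mulVec] using congrArg Complex.im (congrFun hxw i)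
  have h1 := h (fun i => (x i).re) fun i => (w i).re
  have h2 := h (fun i => (x i).im) fun i => (w i).im
  rw [hre] at h1
  rw [him] at h2
  have hre0 := hX.dotProduct_mulVec_nonneg fun i => (x i).re
  have him0 := hX.dotProduct_mulVec_nonneg fun i => (x i).im
  rw [star_trivial] at hre0 him0
  have hz2 : 1 ≤ z.re ^ 2 + z.im ^ 2 := by
    have := Complex.normSq_eq_norm_sq z
    rw [Complex.normSq_apply] at this
    nlinarith
  simp only [mulVec_add, mulVec_sub, mulVec_smul, add_dotProduct, dotProduct_add, sub_dotProduct,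
    dotProduct_sub, smul_dotProduct, dotProduct_smul, smul_eq_mul] at h1 h2
  nlinarith [mul_nonneg (sub_nonneg.2 hz2) (add_nonneg hre0 him0)]

theorem exists_sum_normSq_mulVec_le {ι κ : Type*} [Fintype ι] [DecidableEq ι] [Fintype κ]
    (F : Matrix κ ι ℝ) :
    ∃ c : ℝ, 0 < c ∧ ∀ x : ι → ℂ, ∑ i, Complex.normSq ((F.map Complex.ofReal *ᵥ x) i) ≤
      c * ∑ i, Complex.normSq (x i) := by
  obtain ⟨c, hc, h⟩ := exists_smul_one_sub_posSemidef (isHermitian_conjTranspose_mul_self F)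
  have hreal : ∀ v : ι → ℝ, (F *ᵥ v) ⬝ᵥ (F *ᵥ v) ≤ c * (v ⬝ᵥ v) := fun v => by
    have := h.dotProduct_mulVec_nonneg v
    rw [star_trivial, conjTranspose_eq_transpose_of_trivial, sub_mulVec, dotProduct_sub,
      smul_mulVec, one_mulVec, dotProduct_smul, smul_eq_mul, ← mulVec_mulVec, dotProduct_mulVec,
      vecMul_transpose] at this
    linarith
  refine ⟨c, hc, fun x => ?_⟩
  simp only [sum_normSq_eq_dotProduct, re_map_ofReal_mulVec, im_map_ofReal_mulVec]
  linarith [hreal fun i => (x i).re, hreal fun i => (x i).im]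

theorem posSemidef_smul_one_sub_gram {ι κ : Type*} [Fintype ι] [DecidableEq ι] [Fintype κ]
    {T : Matrix κ ι ℂ} {δ : ℝ}
    (h : ∀ w : ι → ℂ, ∑ i, Complex.normSq ((T *ᵥ w) i) ≤ δ ^ 2 * ∑ i, Complex.normSq (w i)) :
    ((δ : ℂ) ^ 2 • (1 : Matrix ι ι ℂ) - Tᴴ * T).PosSemidef := by
  refine .of_dotProduct_mulVec_nonneg ((isHermitian_one.smul ?_).sub
    (isHermitian_conjTranspose_mul_self T)) fun w => ?_
  · simp [IsSelfAdjoint]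
  · rw [sub_mulVec, dotProduct_sub, smul_mulVec, one_mulVec, dotProduct_smul, smul_eq_mul,
      ← mulVec_mulVec, dotProduct_mulVec _ Tᴴ, vecMul_conjTranspose, star_star,
      star_dotProduct_self_complex, star_dotProduct_self_complex]
    have := sub_nonneg.2 (h w)
    exact_mod_cast this

/-- Lemma 4: for reachable `(A,B)` with all eigenvalues of `A` of modulus 1,
for every `γ > 1` there exist `ε_γ > 0` and a stabilizing positive definite
solution `X` of the ARE `X = AᵀX[I + (1 − γ⁻²)BBᵀX]⁻¹A + ε_γ I` with
`BᵀXB < γ²I`; the resulting gain `F = [I + (1 − γ⁻²)BᵀXB]⁻¹BᵀXA` makes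
`A − BF` Schur stable and achieves `‖T_F‖_{H∞} < γ`. -/
theorem stmt16 (n m : ℕ)
    (A : Matrix (Fin n) (Fin n) ℝ) (B : Matrix (Fin n) (Fin m) ℝ)
    (hspec : ∀ c ∈ spectrum ℂ (A.map Complex.ofReal), ‖c‖ = 1)
    (hreach : ∀ w : Fin n → ℝ, (∀ k : ℕ, Bᵀ *ᵥ ((Aᵀ) ^ k *ᵥ w) = 0) → w = 0) :
    ∀ γ : ℝ, 1 < γ →
    ∃ (ε : ℝ) (X : Matrix (Fin n) (Fin n) ℝ), 0 < ε ∧ X.PosDef ∧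
      IsUnit ((1 : Matrix (Fin n) (Fin n) ℝ) + (1 - γ⁻¹ ^ 2) • (B * Bᵀ * X)) ∧
      X = Aᵀ * X *
          ((1 : Matrix (Fin n) (Fin n) ℝ) + (1 - γ⁻¹ ^ 2) • (B * Bᵀ * X))⁻¹ * A
          + ε • (1 : Matrix (Fin n) (Fin n) ℝ) ∧
      (γ ^ 2 • (1 : Matrix (Fin m) (Fin m) ℝ) - Bᵀ * X * B).PosDef ∧
      ∀ F : Matrix (Fin m) (Fin n) ℝ,
        F = ((1 : Matrix (Fin m) (Fin m) ℝ) + (1 - γ⁻¹ ^ 2) • (Bᵀ * X * B))⁻¹ *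
              (Bᵀ * X * A) →
        (∀ c ∈ spectrum ℂ ((A - B * F).map Complex.ofReal), ‖c‖ < 1) ∧
        ∃ δ : ℝ, 0 < δ ∧ δ < γ ∧
          ∀ z : ℂ, 1 < ‖z‖ →
            (((δ : ℂ) ^ 2) • (1 : Matrix (Fin m) (Fin m) ℂ) -
              ((F.map Complex.ofReal) *
                  (z • (1 : Matrix (Fin n) (Fin n) ℂ) -
                    (A - B * F).map Complex.ofReal)⁻¹ *
                  (B.map Complex.ofReal))ᴴ *
              ((F.map Complex.ofReal) *
                  (z • (1 : Matrix (Fin n) (Fin n) ℂ) -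
                    (A - B * F).map Complex.ofReal)⁻¹ *
                  (B.map Complex.ofReal))).PosSemidef := by
  intro γ hγ
  have hβ : 0 < 1 - γ⁻¹ ^ 2 := by
    have h1 : γ⁻¹ < 1 := inv_lt_one_of_one_lt₀ hγ
    have h0 : 0 < γ⁻¹ := by positivity
    nlinarith
  obtain ⟨ε, X, hε, hX, hric, hBXB⟩ := exists_small_riccati_solution hspec hreach hβ
    (show 1 < γ ^ 2 by nlinarith)
  have hXd := (isUnit_iff_isUnit_det _).1 hX.isUnit
  have hS : ((1 - γ⁻¹ ^ 2) • (B * Bᵀ)).PosSemidef := by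
    rw [← conjTranspose_eq_transpose_of_trivial B]
    exact (posSemidef_self_mul_conjTranspose B).smul hβ.le
  have hfactor : (1 : Matrix (Fin n) (Fin n) ℝ) + (1 - γ⁻¹ ^ 2) • (B * Bᵀ * X) =
      (X⁻¹ + (1 - γ⁻¹ ^ 2) • (B * Bᵀ)) * X := by
    rw [add_mul, nonsing_inv_mul _ hXd, smul_mul_assoc]
  have hunit : IsUnit ((1 : Matrix (Fin n) (Fin n) ℝ) + (1 - γ⁻¹ ^ 2) • (B * Bᵀ * X)) := by
    rw [hfactor]
    exact (hX.inv.add_posSemidef hS).isUnit.mul hX.isUnit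
  have hric' : X = Aᵀ * X *
      ((1 : Matrix (Fin n) (Fin n) ℝ) + (1 - γ⁻¹ ^ 2) • (B * Bᵀ * X))⁻¹ * A
        + ε • (1 : Matrix (Fin n) (Fin n) ℝ) := by
    rw [hfactor, Matrix.mul_inv_rev, mul_assoc Aᵀ, mul_nonsing_inv_cancel_left _ _ hXd]
    exact hric
  refine ⟨ε, X, hε, hX, hunit, hric', hBXB, fun F hF => ?_⟩
  have hdiss := riccati_dissipation hγ hX hunit hric' hBXB.posSemidef hF
  have hstable : ∀ c ∈ spectrum ℂ ((A - B * F).map Complex.ofReal), ‖c‖ < 1 := fun c hc => by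
    obtain ⟨u, hu0, hu⟩ := mem_spectrum_iff_exists_mulVec.1 hc
    by_contra! hc1
    have h := complex_dissipation hX.posSemidef hdiss hc1 (x := u) (w := 0) (by simpa using hu)
    obtain ⟨i, hi⟩ := Function.ne_iff.1 hu0
    have hpos : 0 < ∑ i, Complex.normSq (u i) := Finset.sum_pos'
      (fun i _ => Complex.normSq_nonneg _) ⟨i, Finset.mem_univ i, Complex.normSq_pos.2 hi⟩
    have hF0 : 0 ≤ ∑ i, Complex.normSq ((F.map Complex.ofReal *ᵥ u) i) :=
      Finset.sum_nonneg fun i _ => Complex.normSq_nonneg _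
    simp only [Pi.zero_apply, map_zero, Finset.sum_const_zero, mul_zero] at h
    nlinarith [mul_pos hε hpos]
  obtain ⟨c, hc, hFc⟩ := exists_sum_normSq_mulVec_le F
  have hr : 1 < 1 + ε / c := by linarith [div_pos hε hc]
  have hsqrt : 1 < √(1 + ε / c) := Real.lt_sqrt_of_sq_lt (by linarith)
  refine ⟨hstable, γ / √(1 + ε / c), by positivity, div_lt_self (by linarith) hsqrt,
    fun z hz => posSemidef_smul_one_sub_gram fun w => ?_⟩
  set K := (A - B * F).map Complex.ofReal with hK
  have hzK : IsUnit (z • (1 : Matrix (Fin n) (Fin n) ℂ) - K) := by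
    by_contra h
    refine absurd (hstable z ?_) hz.not_gt
    rwa [spectrum.mem_iff, Algebra.algebraMap_eq_smul_one]
  rw [← mulVec_mulVec, ← mulVec_mulVec]
  set x := (z • (1 : Matrix (Fin n) (Fin n) ℂ) - K)⁻¹ *ᵥ (B.map Complex.ofReal *ᵥ w) with hx
  have hxw : K *ᵥ x + B.map Complex.ofReal *ᵥ w = z • x := by
    have : (z • (1 : Matrix (Fin n) (Fin n) ℂ) - K) *ᵥ x = B.map Complex.ofReal *ᵥ w := by
      rw [hx, mulVec_mulVec, mul_nonsing_inv _ ((isUnit_iff_isUnit_det _).1 hzK), one_mulVec]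
    rw [← this, sub_mulVec, smul_mulVec, one_mulVec]
    abel
  have h := complex_dissipation hX.posSemidef hdiss hz.le hxw
  have hx0 := hFc x
  rw [div_pow, Real.sq_sqrt (by linarith), div_mul_eq_mul_div, le_div_iff₀ (by linarith)]
  have hscaled : ε / c * ∑ i, Complex.normSq ((F.map Complex.ofReal *ᵥ x) i) ≤
      ε * ∑ i, Complex.normSq (x i) := by
    rw [div_mul_eq_mul_div, div_le_iff₀ hc]
    nlinarith
  linarith
end
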